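/- arXiv:1109.4466 — 2 statements merged into one kernel-verified Lean document; each statement's English description precedes it below -/
import Mathlib

section
/- Let (C_λ) be a filtered directed system over a field K with structure maps a_{λ₁,λ₂}. Suppose each C_λ carries a linear map ∂_λ : C_λ → C_λ with ∂_λ ∘ ∂_λ = 0 such that a_{λ₁,λ₂} ∘ ∂_{λ₁} = ∂_{λ₂} ∘ a_{λ₁,λ₂} for all λ₁ ≤ λ₂. Suppose each C_λ carries an increasing chain of subspaces F^λ_0 ⊆ F^λ_1 ⊆ F^λ_2 ⊆ ⋯ whose union is C_λ, with ∂_λ(F^λ_i) ⊆ F^λ_i and a_{λ₁,λ₂}(F^{λ₁}_i) ⊆ F^{λ₂}_i for all i; set F^λ_{−1} = 0. For each i, ∂_λ induces a differential on the quotient F^λ_i / F^λ_{i−1}, and the maps a_{x,y} induce linear maps ā^i_{x,y} : H(F^x_i / F^x_{i−1}, ∂_x) → H(F^y_i / F^y_{i−1}, ∂_y) on homology. Assume: (1) there is a constant M > 1 such that ā^i_{x,y} is an isomorphism for all i ≥ 0 and all y > x ≥ M·i; (2) there is a constant N > 1 such that F^λ_i = F^λ_j for all j ≥ i ≥ ⌊Nλ⌋.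 Then the filtered directed system (⊕_{i≥0} H(F^λ_i / F^λ_{i−1}, ∂_λ)), with structure maps ⊕_i ā^i_{x,y}, is bigger than the filtered directed system (H(C_λ, ∂_λ)) with structure maps induced by a_{λ₁,λ₂}. -/
open Module

theorem one_le_mul_real {C x : ℝ} (hC : 1 ≤ C) (hx : 1 ≤ x) : 1 ≤ C * x := by nlinarith

theorem le_mul_left_real {C x : ℝ} (hC : 1 ≤ C) (hx : 1 ≤ x) : x ≤ C * x := by nlinarith

theorem bigger_aux {B C x y : ℝ} (hB : 1 ≤ B) (hC : 1 ≤ C) (hBC : B ≤ C) (hx : 1 ≤ x)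
    (hy : 1 ≤ y) : B * x ≤ C * y * x :=
  mul_le_mul_of_nonneg_right (by nlinarith) (by linarith)

/-- A filtered directed system of finite-dimensional `K`-vector spaces indexed by `[1,∞)`. -/
structure FDS (K : Type) [Field K] where
  V : ∀ x : ℝ, 1 ≤ x → Type
  [addCommGroup : ∀ x hx, AddCommGroup (V x hx)]
  [module : ∀ x hx, Module K (V x hx)]
  [finiteDimensional : ∀ x hx, FiniteDimensional K (V x hx)]
  map : ∀ (x y : ℝ) (hx : 1 ≤ x) (hxy : x ≤ y), V x hx →ₗ[K] V y (hx.trans hxy)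
  map_id : ∀ (x : ℝ) (hx : 1 ≤ x), map x x hx le_rfl = LinearMap.id
  map_comp : ∀ (x y z : ℝ) (hx : 1 ≤ x) (hxy : x ≤ y) (hyz : y ≤ z),
    (map y z (hx.trans hxy) hyz).comp (map x y hx hxy) = map x z hx (hxy.trans hyz)

attribute [instance] FDS.addCommGroup FDS.module FDS.finiteDimensional

/-- The homology `ker d / im d` of a differential `d`. -/
abbrev Homology (K : Type) [Field K] {V : Type} [AddCommGroup V] [Module K V]
    (d : V →ₗ[K] V) : Type :=
  ↥(LinearMap.ker d) ⧸ (LinearMap.range d).comap (LinearMap.ker d).subtype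

/-- The map induced on homology by a linear map `φ` commuting with the differentials. -/
def homologyMap (K : Type) [Field K] {V W : Type} [AddCommGroup V] [Module K V]
    [AddCommGroup W] [Module K W] (d : V →ₗ[K] V) (d' : W →ₗ[K] W) (φ : V →ₗ[K] W)
    (hcomm : φ.comp d = d'.comp φ) : Homology K d →ₗ[K] Homology K d' :=
  Submodule.mapQ _ _
    (φ.restrict (p := LinearMap.ker d) (q := LinearMap.ker d') (fun v hv => by
      have h := LinearMap.congr_fun hcomm v
      simp only [LinearMap.comp_apply] at h
      simp only [LinearMap.mem_ker] at hv ⊢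
      rw [← h, hv, map_zero]))
    (by
      rintro ⟨v, hvker⟩ hv
      simp only [Submodule.mem_comap, Submodule.subtype_apply] at hv
      obtain ⟨u, hu⟩ := hv
      simp only [Submodule.mem_comap, Submodule.subtype_apply, LinearMap.restrict_coe_apply]
      refine ⟨φ u, ?_⟩
      have h := LinearMap.congr_fun hcomm u
      simp only [LinearMap.comp_apply] at h
      rw [← h, hu])

/-- `F_{i-1}`, with the convention `F_{-1} = 0`. -/
def prevSub {K : Type} [Field K] {V : Type} [AddCommGroup V] [Module K V]
    (F : ℕ → Submodule K V) : ℕ → Submodule K V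
  | 0 => ⊥
  | n + 1 => F n

/-- `F_{i-1}` viewed as a submodule of `F_i`. -/
def prevIn (K : Type) [Field K] {V : Type} [AddCommGroup V] [Module K V]
    (F : ℕ → Submodule K V) (i : ℕ) : Submodule K ↥(F i) :=
  (prevSub F i).comap (F i).subtype

/-- The graded piece `F_i / F_{i-1}` of a filtration. -/
abbrev GradedPiece (K : Type) [Field K] {V : Type} [AddCommGroup V] [Module K V]
    (F : ℕ → Submodule K V) (i : ℕ) : Type :=
  ↥(F i) ⧸ prevIn K F i

/-- The map induced on graded pieces by a filtration-preserving linear map. -/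
def gradedMap (K : Type) [Field K] {V W : Type} [AddCommGroup V] [Module K V]
    [AddCommGroup W] [Module K W] (F : ℕ → Submodule K V) (G : ℕ → Submodule K W)
    (φ : V →ₗ[K] W) (hφ : ∀ i, ∀ v ∈ F i, φ v ∈ G i) (i : ℕ) :
    GradedPiece K F i →ₗ[K] GradedPiece K G i :=
  Submodule.mapQ _ _ (φ.restrict (hφ i)) (by
    rintro ⟨v, hvF⟩ hv
    simp only [prevIn, Submodule.mem_comap, Submodule.subtype_apply,
      LinearMap.restrict_coe_apply] at hv ⊢
    cases i with
    | zero =>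
        simp only [prevSub, Submodule.mem_bot] at hv ⊢
        rw [hv, map_zero]
    | succ n => exact hφ n v hv)

/-- Induced maps on graded pieces commute with induced differentials. -/
theorem gradedMap_comm (K : Type) [Field K] {V W : Type} [AddCommGroup V] [Module K V]
    [AddCommGroup W] [Module K W] (F : ℕ → Submodule K V) (G : ℕ → Submodule K W)
    (dV : V →ₗ[K] V) (dW : W →ₗ[K] W) (φ : V →ₗ[K] W)
    (hφd : φ.comp dV = dW.comp φ)
    (hdF : ∀ i, ∀ v ∈ F i, dV v ∈ F i) (hdG : ∀ i, ∀ w ∈ G i, dW w ∈ G i)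
    (hφ : ∀ i, ∀ v ∈ F i, φ v ∈ G i) (i : ℕ) :
    (gradedMap K F G φ hφ i).comp (gradedMap K F F dV hdF i) =
      (gradedMap K G G dW hdG i).comp (gradedMap K F G φ hφ i) := by
  apply LinearMap.ext
  intro q
  obtain ⟨v, rfl⟩ := Submodule.Quotient.mk_surjective _ q
  simp only [LinearMap.comp_apply, gradedMap, Submodule.mapQ_apply]
  congr 1
  apply Subtype.ext
  simp only [LinearMap.restrict_coe_apply]
  have := LinearMap.congr_fun hφd (v : V)
  simpa using this

theorem aux_finrank_homology (K : Type) [Field K] {V : Type} [AddCommGroup V] [Module K V]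
    [FiniteDimensional K V] (d : V →ₗ[K] V) (hd : d.comp d = 0) :
    finrank K (Homology K d) + 2 * finrank K (LinearMap.range d) = finrank K V := by
  have h1 := Submodule.finrank_quotient_add_finrank
    ((LinearMap.range d).comap (LinearMap.ker d).subtype)
  have hle : LinearMap.range d ≤ LinearMap.ker d := LinearMap.range_le_ker_iff.2 hd
  have h2 := (Submodule.comapSubtypeEquivOfLe hle).finrank_eq
  have h3 := LinearMap.finrank_range_add_finrank_ker d
  have h4 : finrank K ((LinearMap.range d).comap (LinearMap.ker d).subtype)
    = finrank K (LinearMap.range d) := h2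
  rw [h4] at h1
  have h5 : finrank K (Homology K d) + finrank K (LinearMap.range d)
    = finrank K (LinearMap.ker d) := h1
  omega

theorem aux_rank_add (K : Type) [Field K] {V : Type} [AddCommGroup V] [Module K V]
    [FiniteDimensional K V] (d : V →ₗ[K] V) (P : Submodule K V) (hP : P ≤ P.comap d) :
    finrank K (P.map d) + finrank K (LinearMap.range (P.mapQ P d hP))
      ≤ finrank K (LinearMap.range d) := by
  have h1 := LinearMap.finrank_range_add_finrank_ker (P.mkQ.domRestrict (LinearMap.range d))
  have h2 : LinearMap.range (P.mkQ.domRestrict (LinearMap.range d))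
      = LinearMap.range (P.mapQ P d hP) := by
    ext q
    constructor
    · rintro ⟨⟨_, v, rfl⟩, rfl⟩
      exact ⟨P.mkQ v, rfl⟩
    · rintro ⟨q, rfl⟩
      obtain ⟨v, rfl⟩ := Submodule.Quotient.mk_surjective _ q
      exact ⟨⟨d v, v, rfl⟩, rfl⟩
  have h3 : finrank K (P.map d) ≤
      finrank K (LinearMap.ker (P.mkQ.domRestrict (LinearMap.range d))) := by
    have hmem : ∀ v : P.map d, (v : V) ∈ LinearMap.range d := by
      rintro ⟨_, v, hv, rfl⟩
      exact ⟨v, rfl⟩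
    have hker : ∀ v : P.map d,
        ((P.map d).subtype.codRestrict (LinearMap.range d) hmem) v ∈
          LinearMap.ker (P.mkQ.domRestrict (LinearMap.range d)) := by
      rintro ⟨_, v, hv, rfl⟩
      rw [LinearMap.mem_ker]
      exact (Submodule.Quotient.mk_eq_zero P).2 (hP hv)
    refine LinearMap.finrank_le_finrank_of_injective
      (f := ((P.map d).subtype.codRestrict (LinearMap.range d) hmem).codRestrict _ hker) ?_
    intro a b hab
    apply Subtype.ext
    exact congrArg (fun t => ((t.1 : LinearMap.range d) : V)) hab
  rw [h2] at h1
  omega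

theorem aux_range_restrict (K : Type) [Field K] {V : Type} [AddCommGroup V] [Module K V]
    (d : V →ₗ[K] V) (P : Submodule K V) (hP : ∀ v ∈ P, d v ∈ P) :
    finrank K (LinearMap.range (d.restrict hP)) = finrank K (P.map d) := by
  rw [← Submodule.finrank_map_subtype_eq]
  refine congrArg (fun S : Submodule K V => finrank K S) ?_
  ext w
  constructor
  · rintro ⟨_, ⟨v, rfl⟩, rfl⟩
    exact ⟨v, v.2, rfl⟩
  · rintro ⟨v, hv, rfl⟩
    exact ⟨_, ⟨⟨v, hv⟩, rfl⟩, rfl⟩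

/-- one step of the dimension bound. -/
theorem aux_step (K : Type) [Field K] {V : Type} [AddCommGroup V] [Module K V]
    [FiniteDimensional K V] (d : V →ₗ[K] V) (hd : d.comp d = 0) (F : ℕ → Submodule K V)
    (hmono : ∀ i, F i ≤ F (i + 1)) (hF : ∀ i, ∀ v ∈ F i, d v ∈ F i) (i : ℕ) :
    finrank K (F i) + 2 * finrank K ((prevSub F i).map d) ≤
      finrank K (Homology K (gradedMap K F F d hF i)) + finrank K (prevSub F i)
        + 2 * finrank K ((F i).map d) := by
  have hle : prevSub F i ≤ F i := by
    cases i with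
    | zero => exact bot_le
    | succ n => exact hmono n
  have hgd : (gradedMap K F F d hF i).comp (gradedMap K F F d hF i) = 0 := by
    apply LinearMap.ext
    intro q
    obtain ⟨v, rfl⟩ := Submodule.Quotient.mk_surjective _ q
    simp only [LinearMap.comp_apply, gradedMap, Submodule.mapQ_apply]
    have : (d.restrict (hF i)) ((d.restrict (hF i)) v) = 0 := by
      apply Subtype.ext
      exact LinearMap.congr_fun hd (v : V)
    rw [this]
    rfl
  have h1 := aux_finrank_homology K _ hgd
  have hP : prevIn K F i ≤ (prevIn K F i).comap (d.restrict (hF i)) := by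
    intro v hv
    cases i with
    | zero =>
      have hv' : (v : V) = 0 := hv
      change d (v : V) = 0
      rw [hv', map_zero]
    | succ n => exact hF n _ hv
  have h2 := aux_rank_add K (d.restrict (hF i)) (prevIn K F i) hP
  have h3 := Submodule.finrank_quotient_add_finrank (prevIn K F i)
  have h4 : finrank K (prevIn K F i) = finrank K (prevSub F i) :=
    (Submodule.comapSubtypeEquivOfLe hle).finrank_eq
  have h5 : finrank K ((prevIn K F i).map (d.restrict (hF i)))
      = finrank K ((prevSub F i).map d) := by
    rw [← Submodule.finrank_map_subtype_eq]
    refine congrArg (fun S : Submodule K V => finrank K S) ?_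
    ext w
    constructor
    · rintro ⟨_, ⟨v, hv, rfl⟩, rfl⟩
      exact ⟨v, hv, rfl⟩
    · rintro ⟨v, hv, rfl⟩
      exact ⟨_, ⟨⟨v, hle hv⟩, hv, rfl⟩, rfl⟩
  have h6 : finrank K (LinearMap.range (d.restrict (hF i))) = finrank K ((F i).map d) :=
    aux_range_restrict K d (F i) (hF i)
  have h7 : finrank K (LinearMap.range (gradedMap K F F d hF i)) =
    finrank K (LinearMap.range ((prevIn K F i).mapQ (prevIn K F i) (d.restrict (hF i)) hP)) := rfl
  have h8 : finrank K (GradedPiece K F i) + finrank K (prevIn K F i) = finrank K (F i) := h3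
  omega

theorem aux_bound (K : Type) [Field K] {V : Type} [AddCommGroup V] [Module K V]
    [FiniteDimensional K V] (d : V →ₗ[K] V) (hd : d.comp d = 0) (F : ℕ → Submodule K V)
    (hmono : ∀ i, F i ≤ F (i + 1)) (hF : ∀ i, ∀ v ∈ F i, d v ∈ F i) (n : ℕ) :
    finrank K (F n) ≤
      (∑ i ∈ Finset.range (n + 1), finrank K (Homology K (gradedMap K F F d hF i)))
        + 2 * finrank K ((F n).map d) := by
  induction n with
  | zero =>
    have := aux_step K d hd F hmono hF 0
    have h0 : prevSub F 0 = ⊥ := rfl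
    rw [h0, Submodule.map_bot, finrank_bot] at this
    simpa using this
  | succ n ih =>
    have := aux_step K d hd F hmono hF (n + 1)
    rw [Finset.sum_range_succ]
    have h0 : prevSub F (n + 1) = F n := rfl
    rw [h0] at this
    omega

theorem aux_finrank_sub (K : Type) [Field K] {V : Type} [AddCommGroup V] [Module K V]
    [FiniteDimensional K V] (d : V →ₗ[K] V) (hd : d.comp d = 0) (F : ℕ → Submodule K V)
    (hmono : ∀ i, F i ≤ F (i + 1)) (hF : ∀ i, ∀ v ∈ F i, d v ∈ F i) (n : ℕ) :
    finrank K (Homology K (d.restrict (hF n))) ≤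
      ∑ i ∈ Finset.range (n + 1), finrank K (Homology K (gradedMap K F F d hF i)) := by
  have h := aux_bound K d hd F hmono hF n
  have h1 := aux_finrank_homology K (d.restrict (hF n)) (by
    apply LinearMap.ext
    intro v
    apply Subtype.ext
    exact LinearMap.congr_fun hd (v : V))
  have h6 : finrank K (LinearMap.range (d.restrict (hF n))) = finrank K ((F n).map d) :=
    aux_range_restrict K d (F n) (hF n)
  omega

theorem aux_factor (K : Type) [Field K] {U V W : Type} [AddCommGroup U] [Module K U]
    [AddCommGroup V] [Module K V] [AddCommGroup W] [Module K W] [FiniteDimensional K V]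
    [FiniteDimensional K W]
    (dU : U →ₗ[K] U) (dV : V →ₗ[K] V) (dW : W →ₗ[K] W) (f : U →ₗ[K] V) (g : V →ₗ[K] W)
    (h : U →ₗ[K] W) (hf : f.comp dU = dV.comp f) (hg : g.comp dV = dW.comp g)
    (hh : h.comp dU = dW.comp h) (e : g.comp f = h) :
    finrank K (LinearMap.range (homologyMap K dU dW h hh)) ≤ finrank K (Homology K dV) := by
  subst e
  have : homologyMap K dU dW (g.comp f) hh
      = (homologyMap K dV dW g hg).comp (homologyMap K dU dV f hf) := by
    apply LinearMap.ext
    intro q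
    obtain ⟨v, rfl⟩ := Submodule.Quotient.mk_surjective _ q
    rfl
  rw [this]
  exact (Submodule.finrank_mono (LinearMap.range_comp_le_range _ _)).trans
    (LinearMap.finrank_range_le _)

theorem aux_dfinsupp (K : Type) [Field K] (X Y : ℕ → Type) [∀ i, AddCommGroup (X i)]
    [∀ i, Module K (X i)] [∀ i, AddCommGroup (Y i)] [∀ i, Module K (Y i)]
    [∀ i, FiniteDimensional K (X i)] [∀ i, FiniteDimensional K (Y i)]
    (L : ∀ i, X i →ₗ[K] Y i) (m n : ℕ) (hm : ∀ i, m ≤ i → Subsingleton (X i))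
    (hn : ∀ i, i < n → Function.Bijective (L i)) :
    ∑ i ∈ Finset.range n, finrank K (X i) ≤
      finrank K (LinearMap.range (DFinsupp.mapRange.linearMap L)) := by
  let pr : (Π₀ i, X i) →ₗ[K] (∀ i : Fin m, X i) :=
    LinearMap.pi (fun i => DFinsupp.lapply (i : ℕ))
  have hpr : Function.Injective pr := by
    intro a b hab
    ext i
    by_cases hi : i < m
    · exact congrFun hab ⟨i, hi⟩
    · have := hm i (not_lt.1 hi)
      exact Subsingleton.elim _ _
  have : FiniteDimensional K (Π₀ i, X i) := Module.Finite.of_injective pr hpr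
  let p : (Π₀ i, Y i) →ₗ[K] (∀ i : Fin n, Y i) :=
    LinearMap.pi (fun i => DFinsupp.lapply (i : ℕ))
  have hs : Function.Surjective
      (p.domRestrict (LinearMap.range (DFinsupp.mapRange.linearMap L))) := by
    intro t
    choose s hs using fun i : Fin n => (hn i i.2).2 (t i)
    refine ⟨⟨_, DFinsupp.mk (Finset.range n) (fun i => s ⟨i, Finset.mem_range.1 i.2⟩), rfl⟩, ?_⟩
    funext i
    change L i (DFinsupp.mk (Finset.range n) (fun i => s ⟨i, Finset.mem_range.1 i.2⟩) i) = t i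
    rw [DFinsupp.mk_apply, dif_pos (Finset.mem_range.2 i.2)]
    exact hs i
  have h1 := LinearMap.finrank_le_finrank_of_surjective hs
  rw [Module.finrank_pi_fintype] at h1
  rw [Finset.sum_range]
  refine le_trans (le_of_eq ?_) h1
  refine Finset.sum_congr rfl fun i _ => ?_
  exact (LinearEquiv.ofBijective (L i) (hn i i.2)).finrank_eq

set_option maxHeartbeats 1000000 in
/-- The spectral sequence bound: let `(C_λ)` be a filtered directed system with a
compatible differential `∂_λ` and a compatible exhausting filtration `F^λ_i` such that
(1) the induced maps on the homology of the graded pieces `ā^i_{x,y}` are isomorphisms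
for `y > x ≥ M·i`, and (2) `F^λ_i = F^λ_j` for `j ≥ i ≥ ⌊N·λ⌋`.  Then the filtered
directed system `(⊕_{i≥0} H(F^λ_i/F^λ_{i-1}, ∂_λ))` is bigger than `(H(C_λ, ∂_λ))`, i.e.
there are constants `A, B, C ≥ 1` with `B ≤ C` such that for all `x, y ≥ 1` the rank of
the image of the structure map of the former from `Bx` to `Cyx` is at least the rank of
the image of the structure map of the latter from `x` to `Ayx`. -/
theorem gradedHomology_bigger_homology (K : Type) [Field K] (𝒞 : FDS K)
    (dl : ∀ (x : ℝ) (hx : 1 ≤ x), 𝒞.V x hx →ₗ[K] 𝒞.V x hx)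
    (hdd : ∀ (x : ℝ) (hx : 1 ≤ x), (dl x hx).comp (dl x hx) = 0)
    (hdcomm : ∀ (x y : ℝ) (hx : 1 ≤ x) (hxy : x ≤ y),
      (𝒞.map x y hx hxy).comp (dl x hx) = (dl y (hx.trans hxy)).comp (𝒞.map x y hx hxy))
    (F : ∀ (x : ℝ) (hx : 1 ≤ x), ℕ → Submodule K (𝒞.V x hx))
    (hFmono : ∀ (x : ℝ) (hx : 1 ≤ x) (i : ℕ), F x hx i ≤ F x hx (i + 1))
    (hFexh : ∀ (x : ℝ) (hx : 1 ≤ x) (v : 𝒞.V x hx), ∃ i, v ∈ F x hx i)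
    (hFd : ∀ (x : ℝ) (hx : 1 ≤ x) (i : ℕ), ∀ v ∈ F x hx i, dl x hx v ∈ F x hx i)
    (hFmap : ∀ (x y : ℝ) (hx : 1 ≤ x) (hxy : x ≤ y) (i : ℕ),
      ∀ v ∈ F x hx i, 𝒞.map x y hx hxy v ∈ F y (hx.trans hxy) i)
    (M : ℝ) (hM : 1 < M)
    (hiso : ∀ (i : ℕ) (x y : ℝ) (hx : 1 ≤ x) (hxy : x < y), M * (i : ℝ) ≤ x →
      Function.Bijective (homologyMap K
        (gradedMap K (F x hx) (F x hx) (dl x hx) (hFd x hx) i)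
        (gradedMap K (F y (hx.trans hxy.le)) (F y (hx.trans hxy.le))
          (dl y (hx.trans hxy.le)) (hFd y (hx.trans hxy.le)) i)
        (gradedMap K (F x hx) (F y (hx.trans hxy.le)) (𝒞.map x y hx hxy.le)
          (hFmap x y hx hxy.le) i)
        (gradedMap_comm K (F x hx) (F y (hx.trans hxy.le)) (dl x hx) (dl y (hx.trans hxy.le))
          (𝒞.map x y hx hxy.le) (hdcomm x y hx hxy.le) (hFd x hx) (hFd y (hx.trans hxy.le))
          (hFmap x y hx hxy.le) i)))
    (N : ℝ) (hN : 1 < N)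
    (hstab : ∀ (x : ℝ) (hx : 1 ≤ x) (i j : ℕ), (⌊N * x⌋ : ℤ) ≤ (i : ℤ) → i ≤ j →
      F x hx i = F x hx j) :
    ∃ (A B C : ℝ) (hA : 1 ≤ A) (hB : 1 ≤ B) (hC : 1 ≤ C) (hBC : B ≤ C),
      ∀ (x y : ℝ) (hx : 1 ≤ x) (hy : 1 ≤ y),
        Module.finrank K (LinearMap.range (homologyMap K
            (dl x hx) (dl (A * y * x) (one_le_mul_real (one_le_mul_real hA hy) hx))
            (𝒞.map x (A * y * x) hx (le_mul_left_real (one_le_mul_real hA hy) hx))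
            (hdcomm x (A * y * x) hx (le_mul_left_real (one_le_mul_real hA hy) hx))))
          ≤ Module.finrank K (LinearMap.range
            (DFinsupp.mapRange.linearMap (fun i : ℕ =>
              homologyMap K
                (gradedMap K (F (B * x) (one_le_mul_real hB hx))
                  (F (B * x) (one_le_mul_real hB hx))
                  (dl (B * x) (one_le_mul_real hB hx)) (hFd (B * x) (one_le_mul_real hB hx)) i)
                (gradedMap K (F (C * y * x) (one_le_mul_real (one_le_mul_real hC hy) hx))
                  (F (C * y * x) (one_le_mul_real (one_le_mul_real hC hy) hx))
                  (dl (C * y * x) (one_le_mul_real (one_le_mul_real hC hy) hx))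
                  (hFd (C * y * x) (one_le_mul_real (one_le_mul_real hC hy) hx)) i)
                (gradedMap K (F (B * x) (one_le_mul_real hB hx))
                  (F (C * y * x) (one_le_mul_real (one_le_mul_real hC hy) hx))
                  (𝒞.map (B * x) (C * y * x) (one_le_mul_real hB hx)
                    (bigger_aux hB hC hBC hx hy))
                  (hFmap (B * x) (C * y * x) (one_le_mul_real hB hx)
                    (bigger_aux hB hC hBC hx hy)) i)
                (gradedMap_comm K (F (B * x) (one_le_mul_real hB hx))
                  (F (C * y * x) (one_le_mul_real (one_le_mul_real hC hy) hx))
                  (dl (B * x) (one_le_mul_real hB hx))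
                  (dl (C * y * x) (one_le_mul_real (one_le_mul_real hC hy) hx))
                  (𝒞.map (B * x) (C * y * x) (one_le_mul_real hB hx)
                    (bigger_aux hB hC hBC hx hy))
                  (hdcomm (B * x) (C * y * x) (one_le_mul_real hB hx)
                    (bigger_aux hB hC hBC hx hy))
                  (hFd (B * x) (one_le_mul_real hB hx))
                  (hFd (C * y * x) (one_le_mul_real (one_le_mul_real hC hy) hx))
                  (hFmap (B * x) (C * y * x) (one_le_mul_real hB hx)
                    (bigger_aux hB hC hBC hx hy)) i)))) := by
  have hMN : 1 ≤ M * N := by nlinarith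
  have hMN2 : 1 ≤ 2 * (M * N) := by linarith
  refine ⟨M * N, M * N, 2 * (M * N), hMN, hMN, hMN2, by linarith, ?_⟩
  intro x y hx hy
  have hz : 1 ≤ M * N * x := one_le_mul_real hMN hx
  have hxz : x ≤ M * N * x := le_mul_left_real hMN hx
  have hzw : M * N * x ≤ M * N * y * x := bigger_aux hMN hMN le_rfl hx hy
  have hzw2 : M * N * x < 2 * (M * N) * y * x := by nlinarith
  obtain ⟨n, hn⟩ := Int.eq_ofNat_of_zero_le (Int.floor_nonneg.2 (by nlinarith : 0 ≤ N * x))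
  have hmon : ∀ i j, i ≤ j → F x hx i ≤ F x hx j := fun i j h => monotone_nat_of_le_succ (hFmono x hx) h
  have htop : ∀ v, v ∈ F x hx n := by
    intro v
    obtain ⟨i, hi⟩ := hFexh x hx v
    rcases le_total i n with h | h
    · exact hmon _ _ h hi
    · rw [hstab x hx n i hn.le h]
      exact hi
  have hnx : (n : ℝ) ≤ N * x := by
    have := Int.floor_le (N * x)
    rw [hn] at this
    simpa using this
  have hMi : ∀ i : ℕ, i < n + 1 → M * (i : ℝ) ≤ M * N * x := by
    intro i hi
    have h1 : (i : ℝ) ≤ n := by exact_mod_cast Nat.lt_succ_iff.1 hi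
    have h2 : (i : ℝ) ≤ N * x := h1.trans hnx
    rw [mul_assoc]
    exact mul_le_mul_of_nonneg_left h2 (by linarith)
  refine le_trans (aux_factor K (dl x hx)
    ((dl (M * N * x) hz).restrict (hFd (M * N * x) hz n)) _
    ((𝒞.map x (M * N * x) hx hxz).codRestrict (F (M * N * x) hz n)
      (fun v => hFmap x _ hx hxz n v (htop v)))
    ((𝒞.map (M * N * x) (M * N * y * x) hz hzw).comp (F (M * N * x) hz n).subtype) _ ?_ ?_ _ ?_) ?_
  · apply LinearMap.ext
    intro v
    apply Subtype.ext
    exact LinearMap.congr_fun (hdcomm x (M * N * x) hx hxz) v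
  · apply LinearMap.ext
    intro v
    exact LinearMap.congr_fun (hdcomm (M * N * x) (M * N * y * x) hz hzw) (v : 𝒞.V _ hz)
  · apply LinearMap.ext
    intro v
    exact LinearMap.congr_fun (𝒞.map_comp x (M * N * x) (M * N * y * x) hx hxz hzw) v
  refine le_trans (aux_finrank_sub K _ (hdd _ hz) _ (hFmono _ hz) (hFd _ hz) n) ?_
  obtain ⟨m, hm⟩ := Int.eq_ofNat_of_zero_le
    (Int.floor_nonneg.2 (by nlinarith : 0 ≤ N * (M * N * x)))
  refine aux_dfinsupp K _ _ _ (m + 1) (n + 1) ?_ ?_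
  · intro i hi
    obtain ⟨j, rfl⟩ : ∃ j, i = j + 1 := ⟨i - 1, by omega⟩
    have hj := hstab (M * N * x) hz j (j + 1) (by omega) (by omega)
    have hsub : Subsingleton (GradedPiece K (F (M * N * x) hz) (j + 1)) := by
      rw [Submodule.Quotient.subsingleton_iff, eq_top_iff]
      rintro ⟨v, hv⟩ -
      change v ∈ F (M * N * x) hz j
      rw [hj]
      exact hv
    have : Subsingleton (LinearMap.ker (gradedMap K (F (M * N * x) hz) (F (M * N * x) hz)
      (dl (M * N * x) hz) (hFd (M * N * x) hz) (j + 1))) := inferInstance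
    exact (Submodule.Quotient.mk_surjective _).subsingleton
  · intro i hi
    exact hiso i _ _ hz hzw2 (hMi i hi)
end

section
/- Let K be a field, V a finite-dimensional K-vector space, and d : V → V a linear map with d ∘ d = 0. Let 0 = F_{−1} ⊆ F_0 ⊆ F_1 ⊆ ⋯ ⊆ F_m = V be a chain of subspaces with d(F_i) ⊆ F_i for every i, and let d̄_i : F_i/F_{i−1} → F_i/F_{i−1} denote the induced map (which satisfies d̄_i ∘ d̄_i = 0). Then dim_K H(V,d) ≤ Σ_{i=0}^{m} dim_K H(F_i/F_{i−1}, d̄_i). -/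
open Module

theorem homology_finrank_aux (K : Type) [Field K] {V : Type} [AddCommGroup V] [Module K V]
    [FiniteDimensional K V] (d : V →ₗ[K] V) (hdd : d.comp d = 0) :
    Module.finrank K (Homology K d) + 2 * Module.finrank K (LinearMap.range d)
      = Module.finrank K V := by
  have hle : LinearMap.range d ≤ LinearMap.ker d := by
    rintro _ ⟨x, rfl⟩
    exact LinearMap.congr_fun hdd x
  have h1 := Submodule.finrank_quotient_add_finrank
    ((LinearMap.range d).comap (LinearMap.ker d).subtype)
  have h2 := LinearMap.finrank_range_add_finrank_ker d
  have h3 := (Submodule.comapSubtypeEquivOfLe hle).finrank_eq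
  simp only [Homology]
  omega

theorem prevSub_le_aux {K : Type} [Field K] {V : Type} [AddCommGroup V] [Module K V]
    (m : ℕ) (F : ℕ → Submodule K V) (hmono : ∀ i < m, F i ≤ F (i + 1))
    (i : ℕ) (hi : i ≤ m) : prevSub F i ≤ F i := by
  cases i with
  | zero => exact bot_le
  | succ n => exact hmono n (by omega)

theorem rank_step_aux (K : Type) [Field K] {V : Type} [AddCommGroup V] [Module K V]
    [FiniteDimensional K V] (d : V →ₗ[K] V) (F : ℕ → Submodule K V) (i : ℕ)
    (hP : prevSub F i ≤ F i)
    (hPinv : ∀ v ∈ prevSub F i, d v ∈ prevSub F i)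
    (hinv : ∀ v ∈ F i, d v ∈ F i)
    (db : GradedPiece K F i →ₗ[K] GradedPiece K F i)
    (hdb : db.comp (prevIn K F i).mkQ = (prevIn K F i).mkQ.comp (d.restrict hinv)) :
    Module.finrank K ((prevSub F i).map d) + Module.finrank K (LinearMap.range db)
      ≤ Module.finrank K ((F i).map d) := by
  set R := LinearMap.range (d.restrict hinv) with hR
  have hRd : Module.finrank K R = Module.finrank K ((F i).map d) := by
    have e : (F i).map d = R.map (F i).subtype := by
      rw [hR, ← LinearMap.range_comp]
      ext y
      constructor
      · rintro ⟨x, hx, rfl⟩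
        exact ⟨⟨x, hx⟩, rfl⟩
      · rintro ⟨x, rfl⟩
        exact ⟨x, x.2, rfl⟩
    rw [e]
    exact (Submodule.finrank_map_subtype_eq (F i) R).symm
  have hr : LinearMap.range ((prevIn K F i).mkQ.domRestrict R) = LinearMap.range db := by
    rw [LinearMap.range_domRestrict, hR, ← LinearMap.range_comp, ← hdb, LinearMap.range_comp,
      Submodule.range_mkQ, Submodule.map_top]
  have h := LinearMap.finrank_range_add_finrank_ker ((prevIn K F i).mkQ.domRestrict R)
  rw [hr, hRd] at h
  have hk : Module.finrank K ((prevSub F i).map d) ≤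
      Module.finrank K (LinearMap.ker ((prevIn K F i).mkQ.domRestrict R)) := by
    refine le_trans (Submodule.finrank_mono ?_)
      (Submodule.finrank_map_le ((F i).subtype.comp R.subtype) _)
    rintro _ ⟨x, hx, rfl⟩
    refine ⟨⟨⟨d x, hinv x (hP hx)⟩, ⟨⟨x, hP hx⟩, rfl⟩⟩, ?_, rfl⟩
    simp only [SetLike.mem_coe, LinearMap.mem_ker, LinearMap.domRestrict_apply,
      Submodule.mkQ_apply, Submodule.Quotient.mk_eq_zero]
    exact hPinv x hx
  rw [Nat.add_comm]
  exact (Nat.add_le_add_left hk _).trans h.le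

/-- Let `d : V → V` be a differential (`d ∘ d = 0`) on a finite-dimensional vector space
and `0 = F_{-1} ⊆ F_0 ⊆ ⋯ ⊆ F_m = V` a chain of `d`-invariant subspaces. For any family
of maps `d̄_i` on the graded pieces `F_i / F_{i-1}` induced by `d` (i.e. compatible with
the quotient projections), `dim H(V,d) ≤ ∑_{i=0}^m dim H(F_i/F_{i-1}, d̄_i)`. -/
theorem finrank_homology_le_sum_finrank_homology_gradedPieces
    (K : Type) [Field K] (V : Type) [AddCommGroup V] [Module K V]
    [FiniteDimensional K V] (d : V →ₗ[K] V) (hdd : d.comp d = 0)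
    (m : ℕ) (F : ℕ → Submodule K V)
    (hmono : ∀ i < m, F i ≤ F (i + 1))
    (htop : F m = ⊤)
    (hinv : ∀ i ≤ m, ∀ v ∈ F i, d v ∈ F i)
    (dbar : ∀ i : ℕ, GradedPiece K F i →ₗ[K] GradedPiece K F i)
    (hdbar : ∀ (i : ℕ) (hi : i ≤ m),
      (dbar i).comp (prevIn K F i).mkQ = (prevIn K F i).mkQ.comp (d.restrict (hinv i hi))) :
    Module.finrank K (Homology K d) ≤
      ∑ i ∈ Finset.range (m + 1), Module.finrank K (Homology K (dbar i)) := by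
  have key : ∀ i ≤ m, Module.finrank K (F i) + 2 * Module.finrank K ((prevSub F i).map d) ≤
      Module.finrank K (prevSub F i) + Module.finrank K (Homology K (dbar i))
        + 2 * Module.finrank K ((F i).map d) := by
    intro i hi
    have hP := prevSub_le_aux m F hmono i hi
    have hPinv : ∀ v ∈ prevSub F i, d v ∈ prevSub F i := by
      cases i with
      | zero =>
        intro v hv
        have hv0 : v = 0 := hv
        rw [hv0, map_zero]
        exact Submodule.zero_mem _
      | succ n => exact hinv n (by omega)
    have h1 := rank_step_aux K d F i hP hPinv (hinv i hi) (dbar i) (hdbar i hi)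
    have hsq : (dbar i).comp (dbar i) = 0 := by
      ext x
      have e := fun y => LinearMap.congr_fun (hdbar i hi) y
      simp only [LinearMap.comp_apply] at e
      simp only [LinearMap.comp_apply]
      rw [e, e]
      have : (d.restrict (hinv i hi)) ((d.restrict (hinv i hi)) x) = 0 :=
        Subtype.ext (LinearMap.congr_fun hdd (x : V))
      rw [this]
      simp
    have h2 := homology_finrank_aux K (dbar i) hsq
    have h3 := Submodule.finrank_quotient_add_finrank (prevIn K F i)
    have h4 : Module.finrank K (prevIn K F i) = Module.finrank K (prevSub F i) :=
      (Submodule.comapSubtypeEquivOfLe hP).finrank_eq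
    simp only [GradedPiece] at *
    omega
  have main : ∀ n ≤ m, Module.finrank K (F n) ≤
      ∑ i ∈ Finset.range (n + 1), Module.finrank K (Homology K (dbar i))
        + 2 * Module.finrank K ((F n).map d) := by
    intro n
    induction n with
    | zero =>
      intro hn
      have h := key 0 hn
      have h0 : Module.finrank K (prevSub F 0) = 0 := finrank_bot K V
      rw [Finset.sum_range_one]
      omega
    | succ n ih =>
      intro hn
      have h := key (n + 1) hn
      have h' := ih (by omega)
      rw [Finset.sum_range_succ]
      have h2 : Module.finrank K (F (n + 1)) + 2 * Module.finrank K ((F n).map d) ≤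
          Module.finrank K (F n) + Module.finrank K (Homology K (dbar (n + 1)))
            + 2 * Module.finrank K ((F (n + 1)).map d) := h
      omega
  have h := main m le_rfl
  have hd := homology_finrank_aux K d hdd
  rw [htop, Submodule.map_top, finrank_top] at h
  omega
end
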